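/- For every integer N ≥ 2 there exist constants 0 < c₁ ≤ c₂ (independent of N) such that c₁ N⁵ ≤ ‖L_Nᵀ Φ_N L_N 1_N‖₂² ≤ c₂ N⁵, and there exist constants 0 < c₁' ≤ c₂' such that c₁' N⁶ ≤ ‖Φ_N L_N 1_N‖₂⁴ ≤ c₂' N⁶; consequently there exist constants 0 < c₁'' ≤ c₂'' such that c₁'' N ≤ (‖L_Nᵀ Φ_N L_N 1_N‖₂² / ‖Φ_N L_N 1_N‖₂⁴)⁻¹ ≤ c₂'' N for all N ≥ 2. -/

import Mathlib

open Matrix BigOperators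

/-- The all-ones vector in `ℝ^N`. -/
noncomputable def onesVec (N : ℕ) : Fin N → ℝ := fun _ => 1

/-- The lower-triangular matrix of ones: `(L_N)_{ij} = 1` if `j ≤ i`, else `0`. -/
noncomputable def Lmat (N : ℕ) : Matrix (Fin N) (Fin N) ℝ :=
  Matrix.of fun i j => if j ≤ i then 1 else 0

/-- The centering matrix `Φ_N = I_N − (1/N) 1_N 1_Nᵀ`. -/
noncomputable def Phi (N : ℕ) : Matrix (Fin N) (Fin N) ℝ :=
  1 - (N : ℝ)⁻¹ • Matrix.of (fun _ _ => (1 : ℝ))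

/-- Squared Euclidean norm of a vector. -/
noncomputable def sqNorm {N : ℕ} (x : Fin N → ℝ) : ℝ := ∑ i, (x i) ^ 2

theorem Lmat_mulVec_onesVec (N : ℕ) (i : Fin N) :
    (Lmat N *ᵥ onesVec N) i = (i : ℝ) + 1 := by
  have h : (Finset.univ.filter fun k : Fin N => k ≤ i) = Finset.Iic i := by
    ext k
    simp
  simp [Matrix.mulVec, dotProduct, Lmat, onesVec, h]

theorem sum_range_natCast_add_one (n : ℕ) :
    ∑ i ∈ Finset.range n, ((i : ℝ) + 1) = n * (n + 1) / 2 := by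
  induction n with
  | zero => simp
  | succ k ih =>
    rw [Finset.sum_range_succ, ih]
    push_cast
    ring

theorem Phi_mulVec_apply (N : ℕ) (x : Fin N → ℝ) (i : Fin N) :
    (Phi N *ᵥ x) i = x i - (N : ℝ)⁻¹ * ∑ k, x k := by
  rw [Phi, Matrix.sub_mulVec, Matrix.one_mulVec, Matrix.smul_mulVec]
  simp [Matrix.mulVec, dotProduct]

theorem Phi_mulVec_Lmat_mulVec_onesVec {N : ℕ} (hN : N ≠ 0) (i : Fin N) :
    (Phi N *ᵥ (Lmat N *ᵥ onesVec N)) i = (i : ℝ) - ((N : ℝ) - 1) / 2 := by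
  have hN' : (N : ℝ) ≠ 0 := Nat.cast_ne_zero.mpr hN
  simp only [Phi_mulVec_apply, Lmat_mulVec_onesVec]
  rw [Fin.sum_univ_eq_sum_range (fun k => (k : ℝ) + 1), sum_range_natCast_add_one]
  field_simp
  ring

theorem sum_range_ite_le_sub (a : ℝ) {j n : ℕ} (h : j ≤ n) :
    ∑ i ∈ Finset.range n, (if j ≤ i then (i : ℝ) - a else 0) =
      ((n : ℝ) - j) * ((n + j - 1) / 2 - a) := by
  induction n, h using Nat.le_induction with
  | base =>
    rw [Finset.sum_eq_zero fun i hi => if_neg (Finset.mem_range.mp hi).not_ge]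
    ring
  | succ k hk ih =>
    rw [Finset.sum_range_succ, ih, if_pos hk]
    push_cast
    ring

theorem Lmat_transpose_mulVec_apply (N : ℕ) (x : Fin N → ℝ) (j : Fin N) :
    ((Lmat N)ᵀ *ᵥ x) j = ∑ i, if j ≤ i then x i else 0 := by
  simp [Matrix.mulVec, dotProduct, Lmat]

theorem Lmat_transpose_mulVec_Phi_mulVec {N : ℕ} (hN : N ≠ 0) (j : Fin N) :
    ((Lmat N)ᵀ *ᵥ (Phi N *ᵥ (Lmat N *ᵥ onesVec N))) j = (j : ℝ) * ((N : ℝ) - j) / 2 := by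
  have h := sum_range_ite_le_sub (((N : ℝ) - 1) / 2) j.isLt.le
  rw [← Fin.sum_univ_eq_sum_range
    (fun i => if (j : ℕ) ≤ i then (i : ℝ) - ((N : ℝ) - 1) / 2 else 0)] at h
  simp only [Lmat_transpose_mulVec_apply, Phi_mulVec_Lmat_mulVec_onesVec hN, Fin.le_def]
  exact h.trans (by ring)

theorem sum_range_natCast_sub_sq (a : ℝ) (n : ℕ) :
    ∑ i ∈ Finset.range n, ((i : ℝ) - a) ^ 2 =
      n * (n - 1) * (2 * n - 1) / 6 - a * (n * (n - 1)) + n * a ^ 2 := by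
  induction n with
  | zero => simp
  | succ k ih =>
    rw [Finset.sum_range_succ, ih]
    push_cast
    ring

theorem sum_range_mul_sub_div_two_sq (a : ℝ) (n : ℕ) :
    ∑ i ∈ Finset.range n, ((i : ℝ) * (a - i) / 2) ^ 2 =
      (a ^ 2 * (n * (n - 1) * (2 * n - 1) / 6) - 2 * a * (n * (n - 1) / 2) ^ 2 +
        n * (n - 1) * (2 * n - 1) * (3 * n ^ 2 - 3 * n - 1) / 30) / 4 := by
  induction n with
  | zero => simp
  | succ k ih =>
    rw [Finset.sum_range_succ, ih]
    push_cast
    ring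

theorem sqNorm_Phi_mulVec {N : ℕ} (hN : N ≠ 0) :
    sqNorm (Phi N *ᵥ (Lmat N *ᵥ onesVec N)) = (N : ℝ) * ((N : ℝ) ^ 2 - 1) / 12 := by
  simp only [sqNorm, Phi_mulVec_Lmat_mulVec_onesVec hN]
  rw [Fin.sum_univ_eq_sum_range (fun i => ((i : ℝ) - ((N : ℝ) - 1) / 2) ^ 2),
    sum_range_natCast_sub_sq]
  ring

theorem sqNorm_Lmat_transpose_mulVec {N : ℕ} (hN : N ≠ 0) :
    sqNorm ((Lmat N)ᵀ *ᵥ (Phi N *ᵥ (Lmat N *ᵥ onesVec N))) =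
      (N : ℝ) * ((N : ℝ) ^ 4 - 1) / 120 := by
  simp only [sqNorm, Lmat_transpose_mulVec_Phi_mulVec hN]
  rw [Fin.sum_univ_eq_sum_range (fun i => ((i : ℝ) * ((N : ℝ) - i) / 2) ^ 2),
    sum_range_mul_sub_div_two_sq]
  ring

theorem stmt_0 :
    (∃ c₁ c₂ : ℝ, 0 < c₁ ∧ c₁ ≤ c₂ ∧ ∀ N : ℕ, 2 ≤ N →
      c₁ * (N : ℝ) ^ 5 ≤ sqNorm ((Lmat N)ᵀ *ᵥ (Phi N *ᵥ (Lmat N *ᵥ onesVec N))) ∧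
      sqNorm ((Lmat N)ᵀ *ᵥ (Phi N *ᵥ (Lmat N *ᵥ onesVec N))) ≤ c₂ * (N : ℝ) ^ 5) ∧
    (∃ c₁' c₂' : ℝ, 0 < c₁' ∧ c₁' ≤ c₂' ∧ ∀ N : ℕ, 2 ≤ N →
      c₁' * (N : ℝ) ^ 6 ≤ (sqNorm (Phi N *ᵥ (Lmat N *ᵥ onesVec N))) ^ 2 ∧
      (sqNorm (Phi N *ᵥ (Lmat N *ᵥ onesVec N))) ^ 2 ≤ c₂' * (N : ℝ) ^ 6) ∧
    (∃ c₁'' c₂'' : ℝ, 0 < c₁'' ∧ c₁'' ≤ c₂'' ∧ ∀ N : ℕ, 2 ≤ N →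
      c₁'' * (N : ℝ) ≤
        (sqNorm ((Lmat N)ᵀ *ᵥ (Phi N *ᵥ (Lmat N *ᵥ onesVec N))) /
          (sqNorm (Phi N *ᵥ (Lmat N *ᵥ onesVec N))) ^ 2)⁻¹ ∧
      (sqNorm ((Lmat N)ᵀ *ᵥ (Phi N *ᵥ (Lmat N *ᵥ onesVec N))) /
          (sqNorm (Phi N *ᵥ (Lmat N *ᵥ onesVec N))) ^ 2)⁻¹ ≤ c₂'' * (N : ℝ)) := by
  refine ⟨⟨1 / 128, 1 / 120, by norm_num, by norm_num, fun N hN => ?_⟩,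
    ⟨1 / 256, 1 / 144, by norm_num, by norm_num, fun N hN => ?_⟩,
    ⟨1 / 2, 5 / 6, by norm_num, by norm_num, fun N hN => ?_⟩⟩
  all_goals
    have hN0 : N ≠ 0 := by omega
    have hx : (2 : ℝ) ≤ N := by exact_mod_cast hN
    simp only [sqNorm_Lmat_transpose_mulVec hN0, sqNorm_Phi_mulVec hN0]
    generalize (N : ℝ) = x at hx
    have hx0 : 0 < x := by linarith
    have h2 : 4 ≤ x ^ 2 := by nlinarith
  · have h4 : 16 ≤ x ^ 4 := by nlinarith
    constructor
    · nlinarith [mul_nonneg hx0.le (sub_nonneg.mpr h4)]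
    · nlinarith
  · have e1 : (x * (x ^ 2 - 1) / 12) ^ 2 = x ^ 2 / 144 * (x ^ 2 - 1) ^ 2 := by ring
    rw [e1]
    constructor
    · have h : (3 / 4 * x ^ 2) ^ 2 ≤ (x ^ 2 - 1) ^ 2 := by
        gcongr
        linarith
      have := mul_le_mul_of_nonneg_left h (by positivity : 0 ≤ x ^ 2 / 144)
      linarith
    · have h : (x ^ 2 - 1) ^ 2 ≤ (x ^ 2) ^ 2 := by
        gcongr <;> linarith
      have := mul_le_mul_of_nonneg_left h (by positivity : 0 ≤ x ^ 2 / 144)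
      linarith
  · have h1 : x ^ 2 - 1 ≠ 0 := by linarith
    have e : (x * (x ^ 4 - 1) / 120 / (x * (x ^ 2 - 1) / 12) ^ 2)⁻¹ =
        x * (5 / 6 * ((x ^ 2 - 1) / (x ^ 2 + 1))) := by
      have e4 : x ^ 4 - 1 = (x ^ 2 - 1) * (x ^ 2 + 1) := by ring
      rw [e4]
      field_simp
      norm_num
    rw [e, mul_comm (1 / 2 : ℝ), mul_comm (5 / 6 : ℝ) x]
    constructor
    · refine mul_le_mul_of_nonneg_left ?_ hx0.le
      have : 3 / 5 ≤ (x ^ 2 - 1) / (x ^ 2 + 1) := by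
        rw [le_div_iff₀ (by positivity)]
        linarith
      linarith
    · refine mul_le_mul_of_nonneg_left ?_ hx0.le
      have : (x ^ 2 - 1) / (x ^ 2 + 1) ≤ 1 := by
        rw [div_le_one (by positivity)]
        linarith
      linarith
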